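/- arXiv:2511.08312 — 4 statements merged into one kernel-verified Lean document; each statement's English description precedes it below -/
import Mathlib

section
/- Left multiplication by the matrix A permutes the six subspaces U₁,…,U₆ of 𝔽₂⁶ according to the 6-cycle (1,5,2,3,4,6); explicitly, the image of U₁ under A is U₅, the image of U₅ is U₂, the image of U₂ is U₃, the image of U₃ is U₄, the image of U₄ is U₆, and the image of U₆ is U₁. In particular the cyclic group generated by A acts simply transitively on the set {U₁,…,U₆}. -/
/-- The vector space `V = 𝔽₂⁶`. -/
abbrev V : Type := Fin 6 → ZMod 2

/-- The standard basis vectors of `V`. -/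
def e (i : Fin 6) : V := Pi.single i 1

/-- The six 2-dimensional subspaces `U₁, …, U₆` of `V` (indexed by `Fin 6`). -/
def U : Fin 6 → Submodule (ZMod 2) V :=
  ![Submodule.span (ZMod 2) {e 4, e 5},
    Submodule.span (ZMod 2) {e 0, e 1},
    Submodule.span (ZMod 2) {e 2, e 3},
    Submodule.span (ZMod 2) {e 0 + e 2 + e 4, e 1 + e 3 + e 4 + e 5},
    Submodule.span (ZMod 2) {e 0 + e 3 + e 5, e 1 + e 2 + e 3 + e 4},
    Submodule.span (ZMod 2) {e 1 + e 2 + e 5, e 0 + e 1 + e 3 + e 4}]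

/-- The matrix `A` over `𝔽₂`. -/
def A : Matrix (Fin 6) (Fin 6) (ZMod 2) :=
  !![0,0,1,1,1,1;
     0,0,0,1,1,0;
     1,1,1,1,1,0;
     0,1,0,1,0,1;
     0,0,1,0,1,0;
     0,0,0,1,1,1]

/-- The first of the two listed generators of `U i`. -/
def gen₁ : Fin 6 → V :=
  ![e 4, e 0, e 2, e 0 + e 2 + e 4, e 0 + e 3 + e 5, e 1 + e 2 + e 5]

/-- The second of the two listed generators of `U i`. -/
def gen₂ : Fin 6 → V :=
  ![e 5, e 1, e 3, e 1 + e 3 + e 4 + e 5, e 1 + e 2 + e 3 + e 4, e 0 + e 1 + e 3 + e 4]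

/-- The 6-cycle `(1,5,2,3,4,6)`, on indices shifted to start at `0`. -/
def next : Fin 6 → Fin 6 := ![4, 2, 3, 5, 1, 0]

theorem U_eq_span (i : Fin 6) : U i = Submodule.span (ZMod 2) {gen₁ i, gen₂ i} := by
  fin_cases i <;> rfl

theorem mem_U_iff {i : Fin 6} {v : V} :
    v ∈ U i ↔ ∃ a b : ZMod 2, a • gen₁ i + b • gen₂ i = v := by
  rw [U_eq_span, Submodule.mem_span_pair]

/-- The subspaces `U i` are pairwise distinct. -/
theorem U_injective : Function.Injective U := by
  have key : ∀ i j : Fin 6, (∃ a b : ZMod 2, a • gen₁ j + b • gen₂ j = gen₁ i) → i = j := by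
    decide +kernel
  intro i j h
  refine key i j (mem_U_iff.1 (h ▸ ?_))
  rw [U_eq_span]
  exact Submodule.subset_span (by simp)

theorem map_A_U (i : Fin 6) : (U i).map A.mulVecLin = U (next i) := by
  have image_mem : ∀ i : Fin 6,
      (∃ a b : ZMod 2, a • gen₁ (next i) + b • gen₂ (next i) = A.mulVec (gen₁ i)) ∧
      (∃ a b : ZMod 2, a • gen₁ (next i) + b • gen₂ (next i) = A.mulVec (gen₂ i)) := by
    decide +kernel
  have mem_image : ∀ i : Fin 6,
      (∃ a b : ZMod 2, a • A.mulVec (gen₁ i) + b • A.mulVec (gen₂ i) = gen₁ (next i)) ∧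
      (∃ a b : ZMod 2, a • A.mulVec (gen₁ i) + b • A.mulVec (gen₂ i) = gen₂ (next i)) := by
    decide +kernel
  have hmap : (U i).map A.mulVecLin =
      Submodule.span (ZMod 2) {A.mulVec (gen₁ i), A.mulVec (gen₂ i)} := by
    rw [U_eq_span, Submodule.map_span, Set.image_pair]
    rfl
  apply le_antisymm
  · rw [hmap, Submodule.span_le, Set.pair_subset_iff]
    exact ⟨mem_U_iff.2 (image_mem i).1, mem_U_iff.2 (image_mem i).2⟩
  · rw [hmap, U_eq_span, Submodule.span_le, Set.pair_subset_iff]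
    exact ⟨Submodule.mem_span_pair.2 (mem_image i).1, Submodule.mem_span_pair.2 (mem_image i).2⟩

theorem map_A_pow_U (n : ℕ) (i : Fin 6) :
    (U i).map (A ^ n).mulVecLin = U (next^[n] i) := by
  induction n with
  | zero => simp
  | succ n ih =>
    rw [pow_succ', Matrix.mulVecLin_mul, Submodule.map_comp, ih, map_A_U,
      Function.iterate_succ_apply']

theorem A_pow_six : A ^ 6 = 1 := by
  decide +kernel

/-- Left multiplication by `A` permutes `U₁, …, U₆` according to the 6-cycle
`(1,5,2,3,4,6)`, and the cyclic group generated by `A` acts simply transitively on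
`{U₁, …, U₆}`. -/
theorem stmt_3 :
    (U 0).map A.mulVecLin = U 4 ∧
    (U 4).map A.mulVecLin = U 1 ∧
    (U 1).map A.mulVecLin = U 2 ∧
    (U 2).map A.mulVecLin = U 3 ∧
    (U 3).map A.mulVecLin = U 5 ∧
    (U 5).map A.mulVecLin = U 0 ∧
    (∀ i j : Fin 6, ∃! g : Matrix (Fin 6) (Fin 6) (ZMod 2),
      g ∈ Submonoid.closure {A} ∧ (U i).map g.mulVecLin = U j) := by
  refine ⟨map_A_U 0, map_A_U 4, map_A_U 1, map_A_U 2, map_A_U 3, map_A_U 5, fun i j => ?_⟩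
  have transitive : ∀ i j : Fin 6, ∃ n : Fin 6, next^[n] i = j := by decide +kernel
  have free : ∀ (i : Fin 6) (m n : Fin 6), next^[m] i = next^[n] i → m = n := by
    decide +kernel
  obtain ⟨n, hn⟩ := transitive i j
  refine ⟨A ^ (n : ℕ), ⟨Submonoid.mem_closure_singleton.2 ⟨n, rfl⟩, by rw [map_A_pow_U, hn]⟩, ?_⟩
  rintro g ⟨hg, hgU⟩
  obtain ⟨m, rfl⟩ := Submonoid.mem_closure_singleton.1 hg
  rw [pow_eq_pow_mod m A_pow_six] at hgU ⊢
  rw [map_A_pow_U] at hgU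
  have h := free i ⟨m % 6, Nat.mod_lt _ (by norm_num)⟩ n ((U_injective hgU).trans hn.symm)
  rw [← h]
end

section
/- Let G be the subgroup of GL₆(𝔽₂) generated by the matrices A and C. Then the set of elements g ∈ G such that left multiplication by g maps each subspace Uᵢ onto itself for all i ∈ {1,…,6} is exactly the cyclic subgroup {1, D, D²} generated by the matrix D; in particular this kernel is cyclic of order 3. -/
/-- The matrix `C` over `𝔽₂`. -/
def C : Matrix (Fin 6) (Fin 6) (ZMod 2) :=
  !![1,1,0,1,0,0;
     1,0,1,1,0,0;
     1,1,1,1,1,0;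
     1,0,1,0,1,1;
     0,1,1,1,0,0;
     1,0,0,1,0,0]

/-- The matrix `D` over `𝔽₂`. -/
def D : Matrix (Fin 6) (Fin 6) (ZMod 2) :=
  !![0,1,0,0,0,0;
     1,1,0,0,0,0;
     0,0,0,1,0,0;
     0,0,1,1,0,0;
     0,0,0,0,1,1;
     0,0,0,0,1,0]

/-- Left multiplication by `g` maps every `Uᵢ` onto itself. -/
def Preserves (g : Matrix (Fin 6) (Fin 6) (ZMod 2)) : Prop :=
  ∀ i : Fin 6, (U i).map g.mulVecLin = U i

theorem Preserves.one : Preserves 1 := fun i => by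
  rw [Matrix.mulVecLin_one, Submodule.map_id]

theorem Preserves.mul {g h : Matrix (Fin 6) (Fin 6) (ZMod 2)} (hg : Preserves g)
    (hh : Preserves h) : Preserves (g * h) := fun i => by
  rw [Matrix.mulVecLin_mul, Submodule.map_comp, hh i, hg i]

theorem D_pow_three : D ^ 3 = 1 := by
  have h : D * D = !![1,1,0,0,0,0; 1,0,0,0,0,0; 0,0,1,1,0,0; 0,0,1,0,0,0;
      0,0,0,0,0,1; 0,0,0,0,1,1] := by decide +kernel
  rw [pow_succ, pow_two, h]
  decide +kernel

theorem map_span_pair_le {g : Matrix (Fin 6) (Fin 6) (ZMod 2)} {u v : V}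
    (hu : ∃ a b : ZMod 2, a • u + b • v = g.mulVec u)
    (hv : ∃ a b : ZMod 2, a • u + b • v = g.mulVec v) :
    (Submodule.span (ZMod 2) {u, v}).map g.mulVecLin ≤ Submodule.span (ZMod 2) {u, v} := by
  rw [Submodule.map_span_le]
  rintro w (rfl | rfl)
  · exact Submodule.mem_span_pair.2 hu
  · exact Submodule.mem_span_pair.2 hv

theorem map_D_le (i : Fin 6) : (U i).map D.mulVecLin ≤ U i := by
  fin_cases i <;> exact map_span_pair_le (by decide +kernel) (by decide +kernel)

theorem preserves_D : Preserves D := fun i => by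
  refine le_antisymm (map_D_le i) ?_
  calc U i = (((U i).map D.mulVecLin).map D.mulVecLin).map D.mulVecLin := by
        rw [← Submodule.map_comp, ← Submodule.map_comp, ← Matrix.mulVecLin_mul,
          ← Matrix.mulVecLin_mul, ← pow_three', D_pow_three, Matrix.mulVecLin_one,
          Submodule.map_id]
    _ ≤ (U i).map D.mulVecLin :=
        Submodule.map_mono ((Submodule.map_mono (map_D_le i)).trans (map_D_le i))

theorem word_sq_eq_D : (A * C * A * (A * C * (C * A))) ^ 2 = D := by
  have hAC : A * C =
      !![1,0,1,1,0,1;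
      1,1,0,1,1,1;
      0,1,0,0,0,1;
      1,0,0,0,1,1;
      1,0,0,0,1,0;
      0,1,0,0,1,1] := by
    decide +kernel
  have hCA : C * A =
      !![0,1,1,1,0,0;
      1,0,0,1,0,0;
      1,0,1,0,0,0;
      1,1,1,1,0,0;
      1,0,1,1,0,1;
      0,1,1,0,1,0] := by
    decide +kernel
  have hACA : A * C * A =
      !![1,0,0,0,1,1;
      0,1,0,0,0,1;
      0,0,0,0,0,1;
      0,0,0,0,1,0;
      0,0,0,1,0,1;
      0,0,1,0,1,1] := by
    rw [hAC]
    decide +kernel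
  have hACCA : A * C * (C * A) =
      !![0,1,0,0,1,0;
      1,1,0,0,1,1;
      1,1,1,1,1,0;
      1,0,1,0,1,1;
      1,1,0,0,0,1;
      0,1,0,0,1,1] := by
    rw [hAC, hCA]
    decide +kernel
  have hw : A * C * A * (A * C * (C * A)) =
      !![1,1,0,0,0,0;
      1,0,0,0,0,0;
      0,1,0,0,1,1;
      1,1,0,0,0,1;
      1,1,1,0,0,0;
      0,1,1,1,0,0] := by
    rw [hACA, hACCA]
    decide +kernel
  rw [hw, pow_two]
  decide +kernel

theorem D_mem_closure : D ∈ Submonoid.closure {A, C} := by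
  have hA : A ∈ Submonoid.closure {A, C} := Submonoid.subset_closure (Set.mem_insert _ _)
  have hC : C ∈ Submonoid.closure {A, C} := Submonoid.subset_closure (Set.mem_insert_of_mem _ rfl)
  rw [← word_sq_eq_D]
  exact pow_mem (mul_mem (mul_mem (mul_mem hA hC) hA) (mul_mem (mul_mem hA hC) (mul_mem hC hA))) 2

theorem Preserves.exists_pair {g : Matrix (Fin 6) (Fin 6) (ZMod 2)} (hg : Preserves g)
    {i : Fin 6} {u v w : V} (hU : U i = Submodule.span (ZMod 2) {u, v}) (hw : w = u ∨ w = v) :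
    ∃ a b : ZMod 2, ∀ k, a * u k + b * v k = g.mulVec w k := by
  have hwU : w ∈ U i := hU ▸ Submodule.subset_span hw
  have h : g.mulVec w ∈ U i := hg i ▸ Submodule.mem_map_of_mem (f := g.mulVecLin) hwU
  rw [hU] at h
  obtain ⟨a, b, hab⟩ := Submodule.mem_span_pair.1 h
  exact ⟨a, b, fun k => congrFun hab k⟩

/-- The general form of a matrix mapping each of the first four `Uᵢ` into itself. -/
def blockMatrix (a b c d : ZMod 2) : Matrix (Fin 6) (Fin 6) (ZMod 2) :=
  !![a,c,0,0,0,0; b,d,0,0,0,0; 0,0,a,c,0,0; 0,0,b,d,0,0;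
     0,0,0,0,a+b,a+b+c+d; 0,0,0,0,b,b+d]

theorem Preserves.exists_eq_blockMatrix {g : Matrix (Fin 6) (Fin 6) (ZMod 2)}
    (hg : Preserves g) : ∃ a b c d : ZMod 2, g = blockMatrix a b c d := by
  obtain ⟨_, _, h4⟩ := hg.exists_pair (i := 0) rfl (.inl rfl)
  obtain ⟨_, _, h5⟩ := hg.exists_pair (i := 0) rfl (.inr rfl)
  obtain ⟨_, _, h0⟩ := hg.exists_pair (i := 1) rfl (.inl rfl)
  obtain ⟨_, _, h1⟩ := hg.exists_pair (i := 1) rfl (.inr rfl)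
  obtain ⟨_, _, h2⟩ := hg.exists_pair (i := 2) rfl (.inl rfl)
  obtain ⟨_, _, h3⟩ := hg.exists_pair (i := 2) rfl (.inr rfl)
  obtain ⟨a, b, h6⟩ := hg.exists_pair (i := 3) rfl (.inl rfl)
  obtain ⟨c, d, h7⟩ := hg.exists_pair (i := 3) rfl (.inr rfl)
  refine ⟨a, b, c, d, ?_⟩
  simp [Fin.forall_fin_succ, Matrix.mulVec_add, e, Pi.single_apply]
    at h0 h1 h2 h3 h4 h5 h6 h7
  ext i j
  fin_cases i <;> fin_cases j <;> simp [blockMatrix] <;> grind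

theorem eq_of_blockMatrix_map_pair : ∀ a b c d : ZMod 2,
    (∃ s t : ZMod 2, ∀ k, s * (e 0 + e 3 + e 5) k + t * (e 1 + e 2 + e 3 + e 4) k =
      (blockMatrix a b c d).mulVec (e 0 + e 3 + e 5) k) →
    (∃ s t : ZMod 2, ∀ k, s * (e 0 + e 3 + e 5) k + t * (e 1 + e 2 + e 3 + e 4) k =
      (blockMatrix a b c d).mulVec (e 1 + e 2 + e 3 + e 4) k) →
    blockMatrix a b c d = 0 ∨ blockMatrix a b c d = 1 ∨ blockMatrix a b c d = D ∨
      blockMatrix a b c d = D * D := by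
  decide +kernel

theorem not_preserves_zero : ¬ Preserves 0 := fun h => by
  have he : e 0 ∈ U 1 := Submodule.subset_span (Set.mem_insert _ _)
  rw [← h 1, Matrix.mulVecLin_zero, Submodule.map_zero, Submodule.mem_bot] at he
  exact absurd he (by decide)

/-- In the group `G` generated by `A` and `C` (realized as the multiplicative closure
of `{A, C}`, which is a group since `G` is finite), the set of elements stabilizing
every subspace `Uᵢ` is exactly `{1, D, D²}`, the cyclic subgroup of order 3 generated
by `D`. -/
theorem stmt_8 :
    {g : Matrix (Fin 6) (Fin 6) (ZMod 2) |
        g ∈ Submonoid.closure {A, C} ∧ ∀ i : Fin 6, (U i).map g.mulVecLin = U i}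
      = {1, D, D ^ 2} ∧
    D ^ 3 = 1 ∧ D ≠ 1 := by
  refine ⟨Set.Subset.antisymm ?_ ?_, D_pow_three, by decide +kernel⟩
  · rintro g ⟨-, hg : Preserves g⟩
    obtain ⟨a, b, c, d, rfl⟩ := hg.exists_eq_blockMatrix
    rcases eq_of_blockMatrix_map_pair a b c d (hg.exists_pair (i := 4) rfl (.inl rfl))
      (hg.exists_pair (i := 4) rfl (.inr rfl)) with h | h | h | h
    · exact absurd (h ▸ hg) not_preserves_zero
    · exact .inl h
    · exact .inr (.inl h)
    · exact .inr (.inr (h.trans (pow_two D).symm))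
  · rintro g (rfl | rfl | rfl)
    · exact ⟨one_mem _, Preserves.one⟩
    · exact ⟨D_mem_closure, preserves_D⟩
    · exact ⟨pow_mem D_mem_closure 2, pow_two D ▸ preserves_D.mul preserves_D⟩
end

section
/- The subgroup of GL₆(𝔽₂) generated by the matrices A and C has order exactly 2160. -/
/-- The matrix over `𝔽₂` whose entries are the binary digits of `m`, six per row. -/
def matrixOfCode (m : ℕ) : Matrix (Fin 6) (Fin 6) (ZMod 2) :=
  fun i j => ((m / 64 ^ (i : ℕ) % 64 / 2 ^ (j : ℕ) : ℕ) : ZMod 2)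

/-- The digit of index `r` of `l` in base `64`. -/
def digit (l r : ℕ) : ℕ := l / 64 ^ r % 64

/-- Apply `f` to the `n` lowest digits of a number in base `64`. -/
def mapDigits (f : ℕ → ℕ) : ℕ → ℕ → ℕ
  | 0, _ => 0
  | n + 1, m => f (m % 64) + 64 * mapDigits f n (m / 64)

theorem mapDigits_div_mod {f : ℕ → ℕ} (hf : ∀ r < 64, f r < 64) {n i : ℕ} (h : i < n) (m : ℕ) :
    mapDigits f n m / 64 ^ i % 64 = f (m / 64 ^ i % 64) := by
  induction n generalizing i m with
  | zero => omega
  | succ n ih =>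
    have h0 := hf (m % 64) (Nat.mod_lt _ (by norm_num))
    cases i with
    | zero => simp only [mapDigits, pow_zero, Nat.div_one]; omega
    | succ i =>
      rw [pow_succ', ← Nat.div_div_eq_div_mul, ← Nat.div_div_eq_div_mul, ← ih (by omega), mapDigits,
        show (f (m % 64) + 64 * mapDigits f n (m / 64)) / 64 = mapDigits f n (m / 64) by omega]

/-- The code of the product of the matrix with code `m` and the matrix `B`, where the digit of
index `r` of `l` codes the product of `B` with the row vector coded by `r`. -/
def mulCode (l m : ℕ) : ℕ := mapDigits (digit l) 6 m

theorem matrixOfCode_mulCode {l : ℕ} {B : Matrix (Fin 6) (Fin 6) (ZMod 2)}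
    (hB : ∀ r < 64, ∀ j : Fin 6, ((digit l r / 2 ^ (j : ℕ) : ℕ) : ZMod 2) =
      ∑ k : Fin 6, ((r / 2 ^ (k : ℕ) : ℕ) : ZMod 2) * B k j) (m : ℕ) :
    matrixOfCode (mulCode l m) = matrixOfCode m * B := by
  ext i j
  rw [matrixOfCode, mulCode,
    mapDigits_div_mod (f := digit l) (fun _ _ => Nat.mod_lt _ (by norm_num)) i.isLt,
    hB _ (Nat.mod_lt _ (by norm_num)), Matrix.mul_apply]
  rfl

theorem matrixOfCode_injOn : Set.InjOn matrixOfCode {m | m < 2 ^ 36} := by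
  intro a ha b hb h
  refine Nat.eq_of_testBit_eq fun k => ?_
  rcases lt_or_ge k 36 with hk | hk
  · have key (m : ℕ) : m.testBit k =
        decide (matrixOfCode m ⟨k / 6, by omega⟩ ⟨k % 6, by omega⟩ = 1) := by
      have h64 : 64 ^ (k / 6) = 2 ^ (6 * (k / 6)) := by rw [pow_mul]; norm_num
      rw [← Bool.coe_iff_coe, decide_eq_true_iff, matrixOfCode, ZMod.natCast_eq_one_iff_odd,
        Nat.odd_iff, h64, show 64 = 2 ^ 6 by norm_num, ← Nat.shiftRight_eq_div_pow,
        ← Nat.shiftRight_eq_div_pow, ← decide_eq_true_iff (p := _ = 1), ← Nat.testBit_zero,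
        Nat.testBit_shiftRight, Nat.testBit_mod_two_pow, Nat.testBit_shiftRight, Nat.add_zero,
        Nat.div_add_mod, decide_eq_true (Nat.mod_lt _ (by norm_num)), Bool.true_and]
    rw [key, key, h]
  · have hp : 2 ^ 36 ≤ 2 ^ k := Nat.pow_le_pow_right (by norm_num) hk
    rw [Nat.testBit_lt_two_pow (lt_of_lt_of_le ha hp),
      Nat.testBit_lt_two_pow (lt_of_lt_of_le hb hp)]

/-- Binary search trees of natural numbers. -/
inductive SearchTree
  | leaf : SearchTree
  | node : SearchTree → ℕ → SearchTree → SearchTree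

namespace SearchTree

/-- The entries of a tree from left to right, followed by the list `acc`. -/
def toListAppend : SearchTree → List ℕ → List ℕ
  | leaf, acc => acc
  | node l v r, acc => l.toListAppend (v :: r.toListAppend acc)

/-- Insertion into a search tree. -/
def insert (x : ℕ) : SearchTree → SearchTree
  | leaf => node leaf x leaf
  | node l v r => bif Nat.blt x v then node (l.insert x) v r else node l v (r.insert x)

/-- Binary search. -/
def contains (x : ℕ) : SearchTree → Bool
  | leaf => false
  | node l v r => bif Nat.blt x v then l.contains x else bif Nat.beq x v then true else r.contains x

theorem mem_toListAppend {x : ℕ} {t : SearchTree} {acc : List ℕ} :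
    x ∈ t.toListAppend acc ↔ x ∈ t.toListAppend [] ∨ x ∈ acc := by
  induction t generalizing acc with
  | leaf => simp [toListAppend]
  | node l v r hl hr =>
    rw [toListAppend, toListAppend, hl, hl (acc := v :: _), List.mem_cons, List.mem_cons, hr]
    tauto

theorem mem_node {x v : ℕ} {l r : SearchTree} : x ∈ (node l v r).toListAppend [] ↔
    x ∈ l.toListAppend [] ∨ x = v ∨ x ∈ r.toListAppend [] := by
  rw [toListAppend, mem_toListAppend, List.mem_cons]

theorem mem_insert {x y : ℕ} {t : SearchTree} (h : y ∈ (t.insert x).toListAppend []) :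
    y = x ∨ y ∈ t.toListAppend [] := by
  induction t with
  | leaf => simpa [insert, toListAppend] using h
  | node l v r hl hr =>
    rw [insert] at h
    rw [mem_node]
    cases hb : Nat.blt x v <;> rw [hb] at h <;> simp only [cond_true, cond_false, mem_node] at h <;>
      tauto

theorem mem_of_contains {x : ℕ} {t : SearchTree} (h : t.contains x = true) :
    x ∈ t.toListAppend [] := by
  induction t with
  | leaf => simp [contains] at h
  | node l v r hl hr =>
    rw [contains] at h
    rw [mem_node]
    cases hb : Nat.blt x v <;> cases hv : Nat.beq x v <;> rw [hb] at h <;>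
      simp only [cond_true, cond_false, hv] at h
    · tauto
    · exact .inr (.inl (Nat.eq_of_beq_eq_true hv))
    · tauto
    · tauto

/-- Depth-first search along `f` and `g`, with at most `n` steps, starting from the numbers in a
list and omitting what has been visited. -/
def search (f g : ℕ → ℕ) : ℕ → List ℕ → SearchTree → SearchTree
  | 0, _, t => t
  | _ + 1, [], t => t
  | n + 1, m :: l, t =>
    bif t.contains m then search f g n l t else search f g n (f m :: g m :: l) (t.insert m)

theorem search_induction {f g : ℕ → ℕ} {P : ℕ → Prop} (hf : ∀ m, P m → P (f m))
    (hg : ∀ m, P m → P (g m)) {n : ℕ} {l : List ℕ} {t : SearchTree} (hl : ∀ m ∈ l, P m)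
    (ht : ∀ m ∈ t.toListAppend [], P m) : ∀ m ∈ (search f g n l t).toListAppend [], P m := by
  induction n generalizing l t with
  | zero => exact ht
  | succ n ih =>
    cases l with
    | nil => exact ht
    | cons a l =>
      have ha := hl a List.mem_cons_self
      have hl' : ∀ m ∈ l, P m := fun m hm => hl m (List.mem_cons_of_mem _ hm)
      rw [search]
      cases t.contains a with
      | true => exact ih hl' ht
      | false =>
        refine ih ?_ fun m hm => (mem_insert hm).elim (fun h => h ▸ ha) (ht m)
        simp only [List.mem_cons, forall_eq_or_imp]
        exact ⟨hf a ha, hg a ha, hl'⟩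

end SearchTree

/-- The products of `A` with all row vectors, in base `64`. -/
def tableA : ℕ :=
  37570278114143106590769621036467246152007465594863529225379500802459637572000557749033377717207180983604025387749120

/-- The products of `C` with all row vectors, in base `64`. -/
def tableC : ℕ :=
  26786870371420582429180087169149473695687538071273114667224381589390056921875700141296128806468174256740455316771520

theorem matrixOfCode_mulCode_tableA :
    ∀ m, matrixOfCode (mulCode tableA m) = matrixOfCode m * A :=
  matrixOfCode_mulCode (by decide +kernel)

theorem matrixOfCode_mulCode_tableC :
    ∀ m, matrixOfCode (mulCode tableC m) = matrixOfCode m * C :=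
  matrixOfCode_mulCode (by decide +kernel)

/-- The code of the identity matrix. -/
def codeOne : ℕ := 34630287489

theorem matrixOfCode_codeOne : matrixOfCode codeOne = 1 := by decide +kernel

/-- The codes of the elements of the group generated by `A` and `C`. -/
def groupTree : SearchTree :=
  SearchTree.search (mulCode tableA) (mulCode tableC) 6481 [codeOne] .leaf

/-- Check that a list of numbers is strictly increasing. -/
def isIncreasing : List ℕ → Bool
  | [] => true
  | [_] => true
  | a :: b :: l => Nat.blt a b && isIncreasing (b :: l)

theorem isChain_of_isIncreasing : ∀ {l : List ℕ}, isIncreasing l = true → l.IsChain (· < ·)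
  | [], _ => .nil
  | [_], _ => .singleton _
  | _ :: _ :: _, h => by
    rw [isIncreasing, Bool.and_eq_true, Nat.blt_eq] at h
    exact .cons_cons h.1 (isChain_of_isIncreasing h.2)

theorem nodup_of_isIncreasing {l : List ℕ} (h : isIncreasing l = true) : l.Nodup :=
  (isChain_of_isIncreasing h).pairwise.imp fun hab => hab.ne

theorem groupTree_check :
    ((groupTree.toListAppend []).all (fun m => Nat.blt m 68719476736 &&
      (groupTree.contains (mulCode tableA m) && groupTree.contains (mulCode tableC m))) &&
      (isIncreasing (groupTree.toListAppend []) && (groupTree.contains codeOne &&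
      Nat.beq (groupTree.toListAppend []).length 2160))) = true := by
  decide +kernel

theorem matrixOfCode_mem_closure {m : ℕ} (hm : m ∈ groupTree.toListAppend []) :
    matrixOfCode m ∈ Submonoid.closure {A, C} := by
  refine SearchTree.search_induction (P := fun m => matrixOfCode m ∈ Submonoid.closure {A, C})
    (fun m h => ?_) (fun m h => ?_) ?_ (by simp [SearchTree.toListAppend]) m hm
  · rw [matrixOfCode_mulCode_tableA]
    exact mul_mem h (Submonoid.subset_closure (by simp))
  · rw [matrixOfCode_mulCode_tableC]
    exact mul_mem h (Submonoid.subset_closure (by simp))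
  · simp only [List.mem_singleton, forall_eq, matrixOfCode_codeOne]
    exact one_mem _

/-- The subgroup of `GL₆(𝔽₂)` generated by `A` and `C` (realized as the multiplicative
closure of `{A, C}`, which is a group since it is finite and consists of invertible
matrices) has order exactly 2160. -/
theorem stmt_10 :
    Nat.card (Submonoid.closure {A, C} : Submonoid (Matrix (Fin 6) (Fin 6) (ZMod 2)))
      = 2160 := by
  have h := groupTree_check
  simp only [Bool.and_eq_true, List.all_eq_true] at h
  obtain ⟨hmem, hinc, hone, hlen⟩ := h
  set L := groupTree.toListAppend []
  have hset : ((Submonoid.closure {A, C} : Submonoid (Matrix (Fin 6) (Fin 6) (ZMod 2))) :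
      Set (Matrix (Fin 6) (Fin 6) (ZMod 2))) = L.toFinset.image matrixOfCode := by
    ext M
    simp only [SetLike.mem_coe, Finset.coe_image, Set.mem_image, List.mem_toFinset]
    constructor
    · intro hM
      induction hM using Submonoid.closure_induction_right with
      | one => exact ⟨codeOne, SearchTree.mem_of_contains hone, matrixOfCode_codeOne⟩
      | mul_right x hx y hy ih =>
        obtain ⟨m, hm, rfl⟩ := ih
        rcases hy with rfl | rfl
        · exact ⟨_, SearchTree.mem_of_contains (hmem m hm).2.1, matrixOfCode_mulCode_tableA m⟩
        · exact ⟨_, SearchTree.mem_of_contains (hmem m hm).2.2, matrixOfCode_mulCode_tableC m⟩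
    · rintro ⟨m, hm, rfl⟩
      exact matrixOfCode_mem_closure hm
  have hinj : Set.InjOn matrixOfCode L.toFinset := matrixOfCode_injOn.mono fun m hm =>
    by simpa [Nat.blt_eq] using (hmem m (List.mem_toFinset.mp hm)).1
  change Nat.card ((Submonoid.closure {A, C} :
    Submonoid (Matrix (Fin 6) (Fin 6) (ZMod 2))) : Set (Matrix (Fin 6) (Fin 6) (ZMod 2))) = 2160
  rw [hset, Nat.card_coe_set_eq, Set.ncard_coe_finset, Finset.card_image_of_injOn hinj,
    List.toFinset_card_of_nodup (nodup_of_isIncreasing hinc)]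
  exact Nat.eq_of_beq_eq_true hlen
end

section
/- The six subspaces U₁,…,U₆ of 𝔽₂⁶ each have dimension 2 over 𝔽₂, they are pairwise distinct, and any two distinct ones intersect trivially: Uᵢ ∩ Uⱼ = {0} whenever i ≠ j. -/
/-- The first listed generator of each `U i`. -/
def U.fstGen : Fin 6 → V :=
  ![e 4, e 0, e 2, e 0 + e 2 + e 4, e 0 + e 3 + e 5, e 1 + e 2 + e 5]

/-- The second listed generator of each `U i`. -/
def U.sndGen : Fin 6 → V :=
  ![e 5, e 1, e 3, e 1 + e 3 + e 4 + e 5, e 1 + e 2 + e 3 + e 4, e 0 + e 1 + e 3 + e 4]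

theorem U_eq_span_pair (i : Fin 6) :
    U i = Submodule.span (ZMod 2) {U.fstGen i, U.sndGen i} := by
  fin_cases i <;> rfl

theorem linearIndependent_gens (i : Fin 6) :
    LinearIndependent (ZMod 2) ![U.fstGen i, U.sndGen i] := by
  rw [LinearIndependent.pair_iff]
  revert i
  decide +kernel

theorem finrank_U (i : Fin 6) : Module.finrank (ZMod 2) (U i) = 2 := by
  have h := finrank_span_eq_card (linearIndependent_gens i)
  rwa [Matrix.range_cons_cons_empty, ← U_eq_span_pair, Fintype.card_fin] at h

theorem combination_eq_zero_of_eq :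
    ∀ i j : Fin 6, i ≠ j → ∀ a b c d : ZMod 2,
      c • U.fstGen j + d • U.sndGen j = a • U.fstGen i + b • U.sndGen i →
        a • U.fstGen i + b • U.sndGen i = 0 := by
  decide +kernel

theorem U_inf_eq_bot {i j : Fin 6} (hij : i ≠ j) : U i ⊓ U j = ⊥ := by
  rw [Submodule.eq_bot_iff]
  rintro x ⟨hi, hj⟩
  rw [SetLike.mem_coe, U_eq_span_pair, Submodule.mem_span_pair] at hi hj
  obtain ⟨a, b, rfl⟩ := hi
  obtain ⟨c, d, h⟩ := hj
  exact combination_eq_zero_of_eq i j hij a b c d h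

theorem U_ne {i j : Fin 6} (hij : i ≠ j) : U i ≠ U j := by
  intro h
  have hbot := U_inf_eq_bot hij
  rw [← h, inf_idem] at hbot
  have hrank := finrank_U i
  rw [hbot, finrank_bot] at hrank
  exact absurd hrank (by norm_num)

/-- The six subspaces `U₁, …, U₆` each have dimension 2 over `𝔽₂`, are pairwise
distinct, and pairwise intersect trivially. -/
theorem stmt_11 :
    (∀ i : Fin 6, Module.finrank (ZMod 2) (U i) = 2) ∧
    (∀ i j : Fin 6, i ≠ j → U i ≠ U j) ∧
    (∀ i j : Fin 6, i ≠ j → U i ⊓ U j = ⊥) :=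
  ⟨finrank_U, fun _ _ => U_ne, fun _ _ => U_inf_eq_bot⟩
end
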